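/- Let β ∈ (0, 1/2^{|S|}), a > 0 and ε ∈ (0, (1/2)·(a/L)^{|S|}·β(1−β)/(L·|S|⁴)). Let q be an irreducible transition matrix on S satisfying the mixing hypothesis with parameter a on S₁, and let q̂ be a transition matrix that is (ε,β)-close to q on S₁ and coincides with q on S\S₁. Then for every nonempty proper subset C of S₁, every s ∈ C and every t ∉ C, |Q_{s,q}(t|C) − Q_{s,q̂}(t|C)| < 12βL. -/

import Mathlib

open Finset

namespace PerturbedMC

variable {S : Type*} [Fintype S] [DecidableEq S]

/-- `q` is a (row-stochastic) transition matrix on `S`: `q s t` is the probability of moving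
from `s` to `t`. -/
def IsTransition (q : Matrix S S ℝ) : Prop :=
  (∀ s t, 0 ≤ q s t) ∧ ∀ s, ∑ t, q s t = 1

/-- `q` is irreducible. -/
def IsIrreducible (q : Matrix S S ℝ) : Prop :=
  ∀ s t, ∃ n : ℕ, 1 ≤ n ∧ 0 < (q ^ n) s t

/-- `μ` is a stationary distribution of `q`. -/
def IsStationary (q : Matrix S S ℝ) (μ : S → ℝ) : Prop :=
  (∀ s, 0 ≤ μ s) ∧ (∑ s, μ s = 1) ∧ ∀ t, ∑ s, μ s * q s t = μ t

/-- The combinatorial constant `L = ∑_{n=1}^{|S|-1} C(|S|,n) · n^{|S|}`. -/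
def Lconst (S : Type*) [Fintype S] : ℕ :=
  ∑ n ∈ Finset.Ico 1 (Fintype.card S), (Fintype.card S).choose n * n ^ Fintype.card S

/-- `ζ_q`: the minimal stationary outflow over nonempty proper subsets of `S`. -/
noncomputable def zeta (q : Matrix S S ℝ) (μ : S → ℝ) : ℝ :=
  sInf {x : ℝ | ∃ C : Finset S, C.Nonempty ∧ C ≠ Finset.univ ∧
    x = ∑ s ∈ C, μ s * ∑ t ∈ Cᶜ, q s t}

/-- `ζ_q^1`: the minimal stationary outflow over nonempty proper subsets of `S₁`. -/
noncomputable def zeta1 (q : Matrix S S ℝ) (μ : S → ℝ) (S1 : Finset S) : ℝ :=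
  sInf {x : ℝ | ∃ C : Finset S, C.Nonempty ∧ C ⊂ S1 ∧
    x = ∑ s ∈ C, μ s * ∑ t ∈ Cᶜ, q s t}

/-- `q̂` is `(ε,β)`-close to `q`, relative to the threshold `z` (`z = ζ_q` or `z = ζ_q^1`):
`|q̂(t|s) − q(t|s)| ≤ β·q(t|s)` whenever `μ_s q(t|s) ≥ ε·z` or `μ_s q̂(t|s) ≥ ε·z`. -/
def IsClose (q qh : Matrix S S ℝ) (μ : S → ℝ) (z ε β : ℝ) : Prop :=
  ∀ s t, (ε * z ≤ μ s * q s t ∨ ε * z ≤ μ s * qh s t) → |qh s t - q s t| ≤ β * q s t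

/-- The substochastic `C × C` restriction `q_C` of `q`. -/
def subMat (q : Matrix S S ℝ) (C : Finset S) : Matrix S S ℝ :=
  fun u v => if u ∈ C ∧ v ∈ C then q u v else 0

/-- The exit distribution `Q_{s,q}(t|C) = Σ_{n≥0} Σ_{u∈C} (q_C^n)(u|s)·q(t|u)`. -/
noncomputable def exitProb (q : Matrix S S ℝ) (C : Finset S) (s t : S) : ℝ :=
  ∑' n : ℕ, ∑ u ∈ C, ((subMat q C ^ n : Matrix S S ℝ) s u) * q u t

/-- The expected exit time `E_{s,q}[T_{C̄}] = Σ_{n≥0} Σ_{u∈C} (q_C^n)(u|s) ∈ [0,∞]`. -/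
noncomputable def expExit (q : Matrix S S ℝ) (C : Finset S) (s : S) : ENNReal :=
  ∑' n : ℕ, ENNReal.ofReal (∑ u ∈ C, (subMat q C ^ n : Matrix S S ℝ) s u)

/-- `g` has a cycle within `C`. -/
def HasCycle (C : Finset S) (g : S → S) : Prop :=
  ∃ (k : ℕ) (f : ℕ → S), 0 < k ∧ f k = f 0 ∧ (∀ i < k, f i ∈ C) ∧ ∀ i < k, g (f i) = f (i + 1)

/-- `g` is a `C`-graph (the values of `g` outside `C` are irrelevant). -/
def IsCGraph (C : Finset S) (g : S → S) : Prop := ¬ HasCycle C g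

/-- `s` leads to `t` along `g`: `t` is the first state outside `C` on the `g`-orbit of `s`. -/
def LeadsTo (C : Finset S) (g : S → S) (s t : S) : Prop :=
  ∃ n : ℕ, g^[n] s = t ∧ t ∉ C ∧ ∀ m < n, g^[m] s ∈ C

/-- The weight `p(g) = Π_{s∈C} q(g(s)|s)` of a `C`-graph under `q`. -/
def wt (q : Matrix S S ℝ) (C : Finset S) (g : S → S) : ℝ := ∏ s ∈ C, q s (g s)

/-- `G(C)`: the canonical representatives of `C`-graphs, namely the maps `S → S` that are
`C`-graphs and are the identity outside `C`. -/
noncomputable def Gset (C : Finset S) : Finset (S → S) :=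
  @Finset.filter _ (fun g => IsCGraph C g ∧ ∀ s ∉ C, g s = s) (Classical.decPred _) Finset.univ

/-- `G_{s,t}(C)`: the `C`-graphs along which `s` leads to `t`. -/
noncomputable def GsetLead (C : Finset S) (s t : S) : Finset (S → S) :=
  @Finset.filter _ (fun g => LeadsTo C g s t) (Classical.decPred _) (Gset C)

/-- `g` is an `η`-maximal `C`-graph under `q`: `p(g) ≥ η · max_{g' ∈ G(C)} p(g')`. -/
def IsMaximal (q : Matrix S S ℝ) (C : Finset S) (η : ℝ) (g : S → S) : Prop :=
  IsCGraph C g ∧ ∀ g', IsCGraph C g' → η * wt q C g' ≤ wt q C g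

/-- `H = G^β(C) ∪ Ĝ^β(C)` as a finset of canonical representatives. -/
noncomputable def Hset (q qh : Matrix S S ℝ) (C : Finset S) (β : ℝ) : Finset (S → S) :=
  @Finset.filter _ (fun g => IsMaximal q C β g ∨ IsMaximal qh C β g)
    (Classical.decPred _) (Gset C)

/-- The mixing hypothesis with parameter `a` on `S₁`: for all `s,t ∈ S₁`, the probability
that the chain started at `s`, from its first step onward, reaches `t` before reaching any
state of `S \ S₁`, is at least `a`. -/
def Mixing (q : Matrix S S ℝ) (S1 : Finset S) (a : ℝ) : Prop :=
  ∀ s ∈ S1, ∀ t ∈ S1,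
    a ≤ q s t + ∑ u ∈ S1.erase t, q s u * exitProb q (S1.erase t) u t

/-- `R` is a recurrent class for `q`. -/
def IsRecClass (q : Matrix S S ℝ) (R : Finset S) : Prop :=
  (∀ s ∈ R, ∑ t ∈ Rᶜ, q s t = 0) ∧
    ∀ s ∈ R, ∀ t ∈ R, ∃ n : ℕ, 1 ≤ n ∧ 0 < (q ^ n) s t

/-- Nonnegative matrices all of whose row sums are at most one. -/
def IsSubstochastic (P : Matrix S S ℝ) : Prop :=
  (∀ s t, 0 ≤ P s t) ∧ ∀ s, ∑ t, P s t ≤ 1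

lemma one_sub_mulVec_apply (P : Matrix S S ℝ) (h : S → ℝ) (i : S) :
    ((1 - P).mulVec h) i = h i - ∑ j, P i j * h j := by
  rw [Matrix.sub_mulVec, Matrix.one_mulVec]
  rfl

/-- Minimum principle for `1 - x P`. -/
lemma IsSubstochastic.nonneg_of_mulVec_nonneg {P : Matrix S S ℝ} (hP : IsSubstochastic P)
    {x : ℝ} (hx0 : 0 ≤ x) (hx1 : x < 1) {h : S → ℝ}
    (hh : ∀ i, 0 ≤ ((1 - x • P).mulVec h) i) (i : S) : 0 ≤ h i := by
  obtain ⟨k, -, hk⟩ := Finset.exists_min_image Finset.univ h ⟨i, Finset.mem_univ i⟩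
  refine le_trans ?_ (hk i (Finset.mem_univ i))
  by_contra! hneg
  have h1 := hh k
  rw [one_sub_mulVec_apply] at h1
  have h2 : x * h k ≤ ∑ j, (x • P) k j * h j := by
    calc x * h k ≤ (x * ∑ j, P k j) * h k := by
          have : x * ∑ j, P k j ≤ x * 1 := mul_le_mul_of_nonneg_left (hP.2 k) hx0
          nlinarith
      _ = ∑ j, (x • P) k j * h k := by
          rw [Finset.mul_sum, Finset.sum_mul]
          rfl
      _ ≤ ∑ j, (x • P) k j * h j := by
          refine Finset.sum_le_sum fun j _ => ?_
          exact mul_le_mul_of_nonneg_left (hk j (Finset.mem_univ j)) (mul_nonneg hx0 (hP.1 k j))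
  nlinarith

lemma IsSubstochastic.det_one_sub_smul_pos {P : Matrix S S ℝ} (hP : IsSubstochastic P)
    {x : ℝ} (hx0 : 0 ≤ x) (hx1 : x < 1) : 0 < (1 - x • P).det := by
  have hne : ∀ y : ℝ, 0 ≤ y → y < 1 → (1 - y • P).det ≠ 0 := by
    intro y hy0 hy1 hdet
    obtain ⟨v, hv, hv0⟩ := Matrix.exists_mulVec_eq_zero_iff.mpr hdet
    refine hv (funext fun i => le_antisymm ?_ ?_)
    · have := hP.nonneg_of_mulVec_nonneg hy0 hy1 (h := -v)
        (fun i => by simp [Matrix.mulVec_neg, hv0]) i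
      simpa using this
    · exact hP.nonneg_of_mulVec_nonneg hy0 hy1 (fun i => by simp [hv0]) i
  by_contra! hle
  have hcont : Continuous fun y : ℝ => (1 - y • P).det :=
    Continuous.matrix_det (by fun_prop)
  have hmem : (0 : ℝ) ∈ Set.Icc ((1 - x • P).det) ((1 - (0 : ℝ) • P).det) := by
    refine ⟨hle, by simp⟩
  obtain ⟨y, ⟨hy0, hy1⟩, hy⟩ := intermediate_value_Icc' hx0 hcont.continuousOn hmem
  exact hne y hy0 (lt_of_le_of_lt hy1 hx1) hy

lemma nonneg_one_of_nonneg_Ico {f : ℝ → ℝ} (hf : Continuous f)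
    (h : ∀ x, 0 ≤ x → x < 1 → 0 ≤ f x) : 0 ≤ f 1 := by
  have hcl : IsClosed {x : ℝ | 0 ≤ f x} := isClosed_le continuous_const hf
  have hsub : Set.Ico (0 : ℝ) 1 ⊆ {x : ℝ | 0 ≤ f x} := fun x hx => h x hx.1 hx.2
  have := hcl.closure_subset_iff.mpr hsub
  rw [closure_Ico (by norm_num)] at this
  exact this ⟨by norm_num, le_rfl⟩

lemma IsSubstochastic.det_one_sub_nonneg {P : Matrix S S ℝ} (hP : IsSubstochastic P) :
    0 ≤ (1 - P).det := by
  have := nonneg_one_of_nonneg_Ico (f := fun y : ℝ => (1 - y • P).det)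
    (Continuous.matrix_det (by fun_prop)) fun x h0 h1 => (hP.det_one_sub_smul_pos h0 h1).le
  simpa using this

lemma mulVec_adjugate_col (A : Matrix S S ℝ) (i j : S) :
    (A.mulVec fun k => A.adjugate k j) i = if i = j then A.det else 0 := by
  have := congrFun (congrFun (Matrix.mul_adjugate A) i) j
  rw [Matrix.mul_apply] at this
  rw [Matrix.mulVec, dotProduct, this, Matrix.smul_apply, Matrix.one_apply]
  simp

lemma IsSubstochastic.adjugate_one_sub_nonneg {P : Matrix S S ℝ} (hP : IsSubstochastic P)
    (i j : S) : 0 ≤ (1 - P).adjugate i j := by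
  have hc : Continuous fun y : ℝ => (1 - y • P).adjugate :=
    Continuous.matrix_adjugate (by fun_prop)
  have := nonneg_one_of_nonneg_Ico (f := fun y : ℝ => (1 - y • P).adjugate i j)
    (hc.matrix_elem i j) fun x h0 h1 => by
      refine hP.nonneg_of_mulVec_nonneg h0 h1 (h := fun k => (1 - x • P).adjugate k j)
        (fun k => ?_) i
      rw [mulVec_adjugate_col]
      split_ifs
      · exact (hP.det_one_sub_smul_pos h0 h1).le
      · exact le_rfl
  simpa using this

lemma IsTransition.isSubstochastic_subMat {q : Matrix S S ℝ} (hq : IsTransition q)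
    (C : Finset S) : IsSubstochastic (subMat q C) := by
  refine ⟨fun s t => ?_, fun s => ?_⟩
  · unfold subMat
    split_ifs
    · exact hq.1 s t
    · exact le_rfl
  · rw [← hq.2 s]
    refine Finset.sum_le_sum fun t _ => ?_
    unfold subMat
    split_ifs
    · exact le_rfl
    · exact hq.1 s t

lemma adjugate_one_sub_subMat_self (q : Matrix S S ℝ) (C : Finset S) (b : S) :
    (1 - subMat q C).adjugate b b = (1 - subMat q (C.erase b)).det := by
  rw [Matrix.adjugate_apply]
  refine Matrix.det_eq_of_forall_row_eq_smul_add_const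
    (fun i => if i = b then 0 else - subMat q C i b) b (by simp) fun i j => ?_
  by_cases hi : i = b
  · subst hi
    simp [subMat, Matrix.one_apply, Pi.single_apply, eq_comm]
  · by_cases hj : j = b
    · subst hj
      simp [hi, subMat]
    · simp [hi, hj, subMat, Matrix.one_apply, Ne.symm hj]

/-- Deleting a state does not decrease `det (1 - q_C)`. -/
lemma IsTransition.det_le_det_erase {q : Matrix S S ℝ} (hq : IsTransition q)
    (C : Finset S) (b : S) :
    (1 - subMat q C).det ≤ (1 - subMat q (C.erase b)).det := by
  have hP := hq.isSubstochastic_subMat C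
  have h1 := mulVec_adjugate_col (1 - subMat q C) b b
  rw [one_sub_mulVec_apply, if_pos rfl, adjugate_one_sub_subMat_self] at h1
  have : 0 ≤ ∑ j, subMat q C b j * (1 - subMat q C).adjugate j b :=
    Finset.sum_nonneg fun j _ => mul_nonneg (hP.1 _ _) (hP.adjugate_one_sub_nonneg _ _)
  linarith

lemma IsTransition.det_le_det_sdiff {q : Matrix S S ℝ} (hq : IsTransition q)
    (C B : Finset S) :
    (1 - subMat q C).det ≤ (1 - subMat q (C \ B)).det := by
  induction B using Finset.induction_on with
  | empty => simp
  | insert b B _ ih =>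
    refine ih.trans ?_
    rw [Finset.sdiff_insert]
    exact hq.det_le_det_erase _ _

/-- The one-step probabilities, from the states of `C`, of jumping to `t`. -/
def exitStep (q : Matrix S S ℝ) (C : Finset S) (t : S) : S → ℝ :=
  fun u => if u ∈ C then q u t else 0

/-- The Cramer numerator of the exit probability. -/
def exitNumer (q : Matrix S S ℝ) (C : Finset S) (s t : S) : ℝ :=
  ((1 - subMat q C).updateCol s (exitStep q C t)).det

lemma exitNumer_eq_sum (q : Matrix S S ℝ) (C : Finset S) (s t : S) :
    exitNumer q C s t = ∑ u, (1 - subMat q C).adjugate s u * exitStep q C t u := by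
  rw [exitNumer, ← Matrix.cramer_apply, Matrix.cramer_eq_adjugate_mulVec]
  rfl

lemma IsTransition.exitStep_nonneg {q : Matrix S S ℝ} (hq : IsTransition q) (C : Finset S)
    (t u : S) : 0 ≤ exitStep q C t u := by
  unfold exitStep
  split_ifs
  · exact hq.1 u t
  · exact le_rfl

lemma IsTransition.exitNumer_nonneg {q : Matrix S S ℝ} (hq : IsTransition q) (C : Finset S)
    (s t : S) : 0 ≤ exitNumer q C s t := by
  rw [exitNumer_eq_sum]
  exact Finset.sum_nonneg fun u _ => mul_nonneg
    ((hq.isSubstochastic_subMat C).adjugate_one_sub_nonneg _ _) (hq.exitStep_nonneg C t u)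

lemma IsTransition.exitStep_le {q : Matrix S S ℝ} (hq : IsTransition q) {C : Finset S}
    {t : S} (ht : t ∉ C) (u : S) : exitStep q C t u ≤ 1 - ∑ v, subMat q C u v := by
  have h1 : exitStep q C t u + ∑ v, subMat q C u v
      = ∑ v, ((if v = t then exitStep q C t u else 0) + subMat q C u v) := by
    rw [Finset.sum_add_distrib]
    simp
  have h2 : exitStep q C t u + ∑ v, subMat q C u v ≤ 1 := by
    rw [h1, ← hq.2 u]
    refine Finset.sum_le_sum fun v _ => ?_
    have := hq.1 u v
    by_cases hu : u ∈ C <;> by_cases hv : v ∈ C <;> by_cases hvt : v = t <;>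
      simp_all [exitStep, subMat]
  linarith

lemma IsTransition.exitNumer_le {q : Matrix S S ℝ} (hq : IsTransition q) {C : Finset S}
    {s t : S} (ht : t ∉ C) : exitNumer q C s t ≤ (1 - subMat q C).det := by
  have h1 : ∑ u, (1 - subMat q C).adjugate s u * (1 - ∑ v, subMat q C u v)
      = (1 - subMat q C).det := by
    have h2 : (1 - subMat q C).adjugate.mulVec ((1 - subMat q C).mulVec fun _ => 1)
        = (1 - subMat q C).det • fun _ => (1 : ℝ) := by
      rw [Matrix.mulVec_mulVec, Matrix.adjugate_mul, Matrix.smul_mulVec, Matrix.one_mulVec]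
    have h3 := congrFun h2 s
    simp only [Matrix.mulVec, dotProduct] at h3
    simp only [Pi.smul_apply, smul_eq_mul, mul_one] at h3
    rw [← h3]
    refine Finset.sum_congr rfl fun u _ => ?_
    congr 1
    simp [Matrix.one_apply]
  rw [exitNumer_eq_sum, ← h1]
  exact Finset.sum_le_sum fun u _ => mul_le_mul_of_nonneg_left (hq.exitStep_le ht u)
    ((hq.isSubstochastic_subMat C).adjugate_one_sub_nonneg _ _)

lemma exitProb_eq_tsum (q : Matrix S S ℝ) (C : Finset S) (s t : S) :
    exitProb q C s t = ∑' n : ℕ, ((subMat q C ^ n).mulVec (exitStep q C t)) s := by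
  unfold exitProb
  refine tsum_congr fun n => ?_
  simp only [Matrix.mulVec, dotProduct, exitStep, mul_ite, mul_zero]
  rw [← Finset.sum_filter]
  simp

lemma IsSubstochastic.pow_nonneg {P : Matrix S S ℝ} (hP : IsSubstochastic P) (n : ℕ) (s t : S) :
    0 ≤ (P ^ n) s t := by
  induction n generalizing s t with
  | zero =>
    rw [pow_zero, Matrix.one_apply]
    split_ifs <;> norm_num
  | succ n ih =>
    rw [pow_succ, Matrix.mul_apply]
    exact Finset.sum_nonneg fun u _ => mul_nonneg (ih _ _) (hP.1 _ _)

lemma IsTransition.exit_term_nonneg {q : Matrix S S ℝ} (hq : IsTransition q) (C : Finset S)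
    (s t : S) (n : ℕ) : 0 ≤ ((subMat q C ^ n).mulVec (exitStep q C t)) s :=
  Finset.sum_nonneg fun u _ => mul_nonneg
    ((hq.isSubstochastic_subMat C).pow_nonneg n _ _) (hq.exitStep_nonneg C t u)

lemma IsTransition.sum_exit_term_le {q : Matrix S S ℝ} (hq : IsTransition q) {C : Finset S}
    {t : S} (ht : t ∉ C) (s : S) (N : ℕ) :
    ∑ n ∈ Finset.range N, ((subMat q C ^ n).mulVec (exitStep q C t)) s ≤ 1 := by
  have hP := hq.isSubstochastic_subMat C
  have h1 : ∀ n, ((subMat q C ^ n).mulVec (exitStep q C t)) s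
      ≤ ((subMat q C ^ n).mulVec fun _ => 1) s - ((subMat q C ^ (n + 1)).mulVec fun _ => 1) s := by
    intro n
    rw [pow_succ, ← Matrix.mulVec_mulVec]
    simp only [Matrix.mulVec, dotProduct]
    rw [← Finset.sum_sub_distrib]
    refine Finset.sum_le_sum fun u _ => ?_
    rw [← mul_sub]
    refine mul_le_mul_of_nonneg_left ?_ (hP.pow_nonneg n _ _)
    simpa using hq.exitStep_le ht u
  refine (Finset.sum_le_sum fun n _ => h1 n).trans ?_
  rw [Finset.sum_range_sub']
  have h2 : 0 ≤ ((subMat q C ^ N).mulVec fun _ => (1 : ℝ)) s :=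
    Finset.sum_nonneg fun u _ => mul_nonneg (hP.pow_nonneg N _ _) zero_le_one
  simp only [pow_zero, Matrix.one_mulVec]
  linarith

lemma IsTransition.summable_exit_term {q : Matrix S S ℝ} (hq : IsTransition q) {C : Finset S}
    {t : S} (ht : t ∉ C) (s : S) :
    Summable fun n : ℕ => ((subMat q C ^ n).mulVec (exitStep q C t)) s :=
  summable_of_sum_range_le (hq.exit_term_nonneg C s t) (hq.sum_exit_term_le ht s)

lemma IsTransition.exitProb_le_one {q : Matrix S S ℝ} (hq : IsTransition q) {C : Finset S}
    {t : S} (ht : t ∉ C) (s : S) : exitProb q C s t ≤ 1 := by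
  rw [exitProb_eq_tsum]
  exact (hq.summable_exit_term ht s).tsum_le_of_sum_range_le (hq.sum_exit_term_le ht s)

lemma IsTransition.exitProb_step {q : Matrix S S ℝ} (hq : IsTransition q) {C : Finset S}
    {t : S} (ht : t ∉ C) (s : S) :
    exitProb q C s t = exitStep q C t s + ∑ u, subMat q C s u * exitProb q C u t := by
  rw [exitProb_eq_tsum, (hq.summable_exit_term ht s).tsum_eq_zero_add]
  congr 1
  · simp
  · simp_rw [exitProb_eq_tsum, ← tsum_mul_left]
    rw [← Summable.tsum_finsetSum fun u _ => (hq.summable_exit_term ht u).mul_left _]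
    refine tsum_congr fun n => ?_
    rw [pow_succ', ← Matrix.mulVec_mulVec]
    rfl

/-- Cramer's rule for the exit distribution. -/
lemma IsTransition.det_mul_exitProb {q : Matrix S S ℝ} (hq : IsTransition q) {C : Finset S}
    {t : S} (ht : t ∉ C) (s : S) :
    (1 - subMat q C).det * exitProb q C s t = exitNumer q C s t := by
  have h1 : (1 - subMat q C).mulVec (fun u => exitProb q C u t) = exitStep q C t := by
    funext u
    rw [one_sub_mulVec_apply, hq.exitProb_step ht u]
    ring
  have h2 : (1 - subMat q C).adjugate.mulVec (exitStep q C t)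
      = (1 - subMat q C).det • fun u => exitProb q C u t := by
    rw [← h1, Matrix.mulVec_mulVec, Matrix.adjugate_mul, Matrix.smul_mulVec, Matrix.one_mulVec]
  rw [exitNumer_eq_sum]
  exact (congrFun h2 s).symm

/-- The deterministic transition matrix of a map. -/
def mapMat (g : S → S) : Matrix S S ℝ := fun s t => if g s = t then 1 else 0

lemma isTransition_mapMat (g : S → S) : IsTransition (mapMat g) := by
  refine ⟨fun s t => ?_, fun s => by simp [mapMat]⟩
  unfold mapMat
  split_ifs <;> norm_num

lemma det_sum_rows (q : Matrix S S ℝ) (row : S → S → S → ℝ) :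
    Matrix.det (fun b j => ∑ y, q b y * row b y j)
      = ∑ g : S → S, (∏ b, q b (g b)) * Matrix.det fun b => row b (g b) := by
  have h1 : (fun b j => ∑ y, q b y * row b y j : Matrix S S ℝ)
      = fun b => ∑ y, q b y • row b y := by
    funext b j
    simp
  have h2 := (Matrix.detRowAlternating (n := S) (R := ℝ)).toMultilinearMap.map_sum
    fun b y => q b y • row b y
  have h3 := fun g : S → S =>
    (Matrix.detRowAlternating (n := S) (R := ℝ)).toMultilinearMap.map_smul_univ
      (fun b => q b (g b)) (fun b => row b (g b))
  rw [h1]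
  refine h2.trans (Finset.sum_congr rfl fun g _ => ?_)
  exact h3 g

lemma sum_mul_ite_eq_one {f : S → ℝ} (p : Prop) [Decidable p] (j : S) :
    ∑ y, f y * (if p ∧ y = j then (1 : ℝ) else 0) = if p then f j else 0 := by
  by_cases hp : p <;> simp [hp]

/-- Expansion of `det (1 - q_D)` over maps. -/
lemma det_eq_sum_maps {q : Matrix S S ℝ} (hq : ∀ s, ∑ t, q s t = 1) (D : Finset S) :
    (1 - subMat q D).det
      = ∑ g : S → S, (∏ b, q b (g b)) * (1 - subMat (mapMat g) D).det := by
  have h := det_sum_rows q fun b y j =>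
    (1 : Matrix S S ℝ) b j - if (b ∈ D ∧ j ∈ D) ∧ y = j then 1 else 0
  have h1 : (1 - subMat q D) = fun b j => ∑ y, q b y *
      ((1 : Matrix S S ℝ) b j - if (b ∈ D ∧ j ∈ D) ∧ y = j then 1 else 0) := by
    funext b j
    simp_rw [mul_sub]
    rw [Finset.sum_sub_distrib, ← Finset.sum_mul, hq, one_mul, sum_mul_ite_eq_one]
    rfl
  rw [h1, h]
  refine Finset.sum_congr rfl fun g _ => ?_
  congr 2
  funext b j
  simp [subMat, mapMat, ite_and]

/-- Expansion of the numerator of the exit probability over maps. -/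
lemma exitNumer_eq_sum_maps {q : Matrix S S ℝ} (hq : ∀ s, ∑ t, q s t = 1) (C : Finset S)
    (s t : S) :
    exitNumer q C s t = ∑ g : S → S, (∏ b, q b (g b)) * exitNumer (mapMat g) C s t := by
  have h := det_sum_rows q fun b y j =>
    if j = s then (if b ∈ C ∧ y = t then 1 else 0) else
      (1 : Matrix S S ℝ) b j - if (b ∈ C ∧ j ∈ C) ∧ y = j then 1 else 0
  have h1 : (1 - subMat q C).updateCol s (exitStep q C t) = fun b j => ∑ y, q b y *
      (if j = s then (if b ∈ C ∧ y = t then 1 else 0) else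
        (1 : Matrix S S ℝ) b j - if (b ∈ C ∧ j ∈ C) ∧ y = j then 1 else 0) := by
    funext b j
    rw [Matrix.updateCol_apply]
    by_cases hj : j = s
    · simp only [hj, if_true]
      rw [sum_mul_ite_eq_one]
      rfl
    · simp only [hj, if_false]
      simp_rw [mul_sub]
      rw [Finset.sum_sub_distrib, ← Finset.sum_mul, hq, one_mul, sum_mul_ite_eq_one]
      rfl
  rw [exitNumer, h1, h]
  refine Finset.sum_congr rfl fun g _ => ?_
  rw [exitNumer]
  congr 2
  funext b j
  rw [Matrix.updateCol_apply]
  by_cases hj : j = s <;> simp [hj, subMat, mapMat, exitStep, ite_and]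

lemma abs_prod_sub_prod_le {ι : Type*} (A : Finset ι) {x x' y : ι → ℝ} (hx : ∀ i, 0 ≤ x i)
    (h : ∀ i, |x' i - x i| ≤ y i - x i) :
    |∏ i ∈ A, x' i - ∏ i ∈ A, x i| ≤ ∏ i ∈ A, y i - ∏ i ∈ A, x i := by
  classical
  induction A using Finset.induction_on with
  | empty => simp
  | insert i A hi ih =>
    rw [Finset.prod_insert hi, Finset.prod_insert hi, Finset.prod_insert hi]
    have hX : 0 ≤ ∏ i ∈ A, x i := Finset.prod_nonneg fun i _ => hx i
    have h1 : |∏ i ∈ A, x' i| ≤ ∏ i ∈ A, y i := by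
      have := abs_sub_abs_le_abs_sub (∏ i ∈ A, x' i) (∏ i ∈ A, x i)
      rw [abs_of_nonneg hX] at this
      linarith
    calc |x' i * ∏ i ∈ A, x' i - x i * ∏ i ∈ A, x i|
        = |(x' i - x i) * ∏ i ∈ A, x' i + x i * (∏ i ∈ A, x' i - ∏ i ∈ A, x i)| := by
          congr 1
          ring
      _ ≤ |x' i - x i| * |∏ i ∈ A, x' i| + x i * |∏ i ∈ A, x' i - ∏ i ∈ A, x i| := by
          refine (abs_add_le _ _).trans ?_
          rw [abs_mul, abs_mul, abs_of_nonneg (hx i)]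
      _ ≤ (y i - x i) * ∏ i ∈ A, y i + x i * (∏ i ∈ A, y i - ∏ i ∈ A, x i) := by
          refine add_le_add ?_ (mul_le_mul_of_nonneg_left ih (hx i))
          exact mul_le_mul (h i) h1 (abs_nonneg _) ((abs_nonneg _).trans (h i))
      _ = y i * ∏ i ∈ A, y i - x i * ∏ i ∈ A, x i := by ring

lemma abs_sum_maps_sub_le {q qh y : Matrix S S ℝ} (hq : ∀ s t, 0 ≤ q s t)
    (h : ∀ s t, |qh s t - q s t| ≤ y s t - q s t) {c w : (S → S) → ℝ} (hc : ∀ g, 0 ≤ c g)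
    (hcw : ∀ g, c g ≤ w g) :
    |∑ g : S → S, (∏ b, qh b (g b)) * c g - ∑ g : S → S, (∏ b, q b (g b)) * c g|
      ≤ ∑ g : S → S, (∏ b, y b (g b)) * w g - ∑ g : S → S, (∏ b, q b (g b)) * w g := by
  rw [← Finset.sum_sub_distrib, ← Finset.sum_sub_distrib]
  refine (Finset.abs_sum_le_sum_abs _ _).trans (Finset.sum_le_sum fun g _ => ?_)
  have h1 := abs_prod_sub_prod_le Finset.univ (x := fun b => q b (g b))
    (x' := fun b => qh b (g b)) (y := fun b => y b (g b)) (fun b => hq _ _) (fun b => h _ _)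
  rw [← sub_mul, ← sub_mul, abs_mul, abs_of_nonneg (hc g)]
  exact mul_le_mul h1 (hcw g) (hc g) ((abs_nonneg _).trans h1)

/-- Two transition matrices whose expansions differ little have close exit distributions. -/
lemma abs_exitProb_sub_le {q qh y : Matrix S S ℝ} (hq : IsTransition q)
    (hqh : IsTransition qh) {C : Finset S} (h : ∀ s t, |qh s t - q s t| ≤ y s t - q s t)
    {η : ℝ} (hη : η < 1) (hpos : 0 < (1 - subMat q C).det)
    (hy : ∑ g : S → S, (∏ b, y b (g b)) * (1 - subMat (mapMat g) C).det
      ≤ (1 + η) * (1 - subMat q C).det) {s t : S} (ht : t ∉ C) :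
    |exitProb q C s t - exitProb qh C s t| ≤ 2 * η := by
  have hw : ∀ g : S → S, 0 ≤ (1 - subMat (mapMat g) C).det := fun g =>
    ((isTransition_mapMat g).isSubstochastic_subMat C).det_one_sub_nonneg
  have hW := abs_sum_maps_sub_le hq.1 h hw fun g => le_rfl
  have hN := abs_sum_maps_sub_le hq.1 h
    (fun g => (isTransition_mapMat g).exitNumer_nonneg C s t)
    (fun g => (isTransition_mapMat g).exitNumer_le (s := s) ht)
  rw [← det_eq_sum_maps hq.2, ← det_eq_sum_maps hqh.2] at hW
  rw [← det_eq_sum_maps hq.2, ← exitNumer_eq_sum_maps hq.2, ← exitNumer_eq_sum_maps hqh.2] at hN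
  have e1 := hq.det_mul_exitProb ht s
  have e2 := hqh.det_mul_exitProb ht s
  have hle := hqh.exitNumer_le (s := s) ht
  have hn0 := hqh.exitNumer_nonneg C s t
  set W := (1 - subMat q C).det
  set W' := (1 - subMat qh C).det
  rw [← e1, ← e2] at hN
  rw [← e2] at hle hn0
  have hW' : 0 < W' := by
    have := (abs_le.mp hW).1
    nlinarith
  have hQ0 : 0 ≤ exitProb qh C s t := by
    by_contra! hneg
    nlinarith
  have hQ1 : exitProb qh C s t ≤ 1 := hqh.exitProb_le_one ht s
  have key : W * |exitProb q C s t - exitProb qh C s t| ≤ W * (2 * η) := by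
    calc W * |exitProb q C s t - exitProb qh C s t|
        = |(W' - W) * exitProb qh C s t - (W' * exitProb qh C s t - W * exitProb q C s t)| := by
          rw [← abs_of_pos hpos, ← abs_mul, abs_of_pos hpos]
          congr 1
          ring
      _ ≤ |W' - W| * exitProb qh C s t + |W' * exitProb qh C s t - W * exitProb q C s t| := by
          refine (abs_sub _ _).trans ?_
          rw [abs_mul, abs_of_nonneg hQ0]
      _ ≤ |W' - W| * 1 + |W' * exitProb qh C s t - W * exitProb q C s t| := by gcongr
      _ ≤ W * (2 * η) := by linarith
  exact le_of_mul_le_mul_left key hpos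

/-- The Dirichlet form of a stationary chain. -/
lemma energy_eq {ι : Type*} [Fintype ι] {q : Matrix ι ι ℝ} {μ : ι → ℝ} (hq : IsTransition q)
    (hμ : IsStationary q μ) (h : ι → ℝ) :
    ∑ x, μ x * h x * (h x - ∑ y, q x y * h y)
      = 1 / 2 * ∑ x, ∑ y, μ x * q x y * (h x - h y) ^ 2 := by
  have h1 : ∑ x, ∑ y, μ x * q x y * h x ^ 2 = ∑ x, μ x * h x ^ 2 := by
    refine Finset.sum_congr rfl fun x _ => ?_
    rw [← Finset.sum_mul, ← Finset.mul_sum, hq.2, mul_one]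
  have h2 : ∑ x, ∑ y, μ x * q x y * h y ^ 2 = ∑ x, μ x * h x ^ 2 := by
    rw [Finset.sum_comm]
    refine Finset.sum_congr rfl fun y _ => ?_
    rw [← Finset.sum_mul, hμ.2.2]
  have h3 : ∑ x, μ x * h x * (h x - ∑ y, q x y * h y)
      = ∑ x, μ x * h x ^ 2 - ∑ x, ∑ y, μ x * q x y * (h x * h y) := by
    rw [← Finset.sum_sub_distrib]
    refine Finset.sum_congr rfl fun x _ => ?_
    rw [mul_sub, Finset.mul_sum]
    congr 1
    · ring
    · exact Finset.sum_congr rfl fun y _ => by ring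
  have h4 : ∑ x, ∑ y, μ x * q x y * (h x - h y) ^ 2
      = ∑ x, ∑ y, μ x * q x y * h x ^ 2 + ∑ x, ∑ y, μ x * q x y * h y ^ 2
        - 2 * ∑ x, ∑ y, μ x * q x y * (h x * h y) := by
    simp_rw [Finset.mul_sum, ← Finset.sum_add_distrib, ← Finset.sum_sub_distrib]
    refine Finset.sum_congr rfl fun x _ => Finset.sum_congr rfl fun y _ => ?_
    ring
  rw [h4, h1, h2, h3]
  ring

/-- A function with maximum level `h b` leaves one of `|ι|` equal levels below `h b` empty. -/
lemma exists_gap {ι : Type*} [Fintype ι] (h : ι → ℝ) (b : ι) {c : ℝ} (hc : 0 < c)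
    (hb : h b = Fintype.card ι * c) :
    ∃ k < Fintype.card ι, ∀ x, h x ≤ k * c ∨ (k + 1) * c ≤ h x := by
  by_contra! hcon
  choose f hf using fun k : Fin (Fintype.card ι) => hcon k k.2
  have hinj : Function.Injective f := by
    intro i j hij
    have hi := hf i
    have hj := hf j
    rw [hij] at hi
    have h1 : (i : ℝ) < j + 1 := by
      have := hi.1.trans hj.2
      exact lt_of_mul_lt_mul_right this hc.le
    have h2 : (j : ℝ) < i + 1 := by
      have := hj.1.trans hi.2
      exact lt_of_mul_lt_mul_right this hc.le
    have h1' : (i : ℕ) < j + 1 := by exact_mod_cast h1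
    have h2' : (j : ℕ) < i + 1 := by exact_mod_cast h2
    exact Fin.ext (by omega)
  have hsurj := ((Fintype.bijective_iff_injective_and_card f).mpr ⟨hinj, by simp⟩).2
  obtain ⟨k, hk⟩ := hsurj b
  have h3 := (hf k).2
  rw [hk, hb] at h3
  have h4 := lt_of_mul_lt_mul_right h3 hc.le
  have h5 : Fintype.card ι < (k : ℕ) + 1 := by exact_mod_cast h4
  omega

/-- A lower bound on the probability of escaping from `b` out of `D` when every nonempty subset
of `D` has stationary outflow at least `z`. -/
lemma outflow_mul_det_erase_le {q : Matrix S S ℝ} {μ : S → ℝ} (hq : IsTransition q)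
    (hμ : IsStationary q μ) {D : Finset S} {b : S} (hb : b ∈ D) {z : ℝ}
    (hz : ∀ A : Finset S, A.Nonempty → A ⊆ D → z ≤ ∑ s ∈ A, μ s * ∑ t ∈ Aᶜ, q s t) :
    z * (1 - subMat q (D.erase b)).det
      ≤ 2 * (Fintype.card S : ℝ) ^ 2 * μ b * (1 - subMat q D).det := by
  set n : ℝ := (Fintype.card S : ℝ) with hn
  have hcard : 0 < Fintype.card S := Fintype.card_pos_iff.mpr ⟨b⟩
  have hnpos : 0 < n := Nat.cast_pos.mpr hcard
  set d := (1 - subMat q D).det with hd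
  have hd0 : 0 ≤ d := (hq.isSubstochastic_subMat D).det_one_sub_nonneg
  set h : S → ℝ := fun x => (1 - subMat q D).adjugate x b with hh
  have hhb : h b = (1 - subMat q (D.erase b)).det := adjugate_one_sub_subMat_self q D b
  have hm0 : 0 ≤ h b := by
    rw [hhb]
    exact (hq.isSubstochastic_subMat _).det_one_sub_nonneg
  rw [← hhb]
  rcases hm0.eq_or_lt with hm | hm
  · rw [← hm, mul_zero]
    have := hμ.1 b
    positivity
  have heq : ∀ x, h x - ∑ y, subMat q D x y * h y = if x = b then d else 0 := fun x => by
    rw [← one_sub_mulVec_apply]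
    exact mulVec_adjugate_col _ x b
  have hoff : ∀ x ∉ D, h x = 0 := by
    intro x hx
    have h1 := heq x
    have hxb : x ≠ b := fun e => hx (e ▸ hb)
    simpa [subMat, hx, hxb] using h1
  have heq' : ∀ x ∈ D, h x - ∑ y, q x y * h y = if x = b then d else 0 := by
    intro x hx
    rw [← heq x]
    congr 1
    refine Finset.sum_congr rfl fun y _ => ?_
    by_cases hy : y ∈ D
    · simp [subMat, hx, hy]
    · simp [hoff y hy]
  have hen : 1 / 2 * ∑ x, ∑ y, μ x * q x y * (h x - h y) ^ 2 = μ b * h b * d := by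
    rw [← energy_eq hq hμ h, Finset.sum_eq_single b]
    · rw [heq' b hb, if_pos rfl]
    · intro x _ hxb
      by_cases hx : x ∈ D
      · rw [heq' x hx, if_neg hxb, mul_zero]
      · rw [hoff x hx]
        ring
    · simp
  set c := h b / n with hc
  have hcpos : 0 < c := div_pos hm hnpos
  have hbc : h b = n * c := by
    rw [hc]
    field_simp
  obtain ⟨k, hk, hgap⟩ := exists_gap h b hcpos hbc
  set A : Finset S := Finset.univ.filter fun x => (k + 1 : ℝ) * c ≤ h x with hA
  have hbA : b ∈ A := by
    simp only [hA, Finset.mem_filter, Finset.mem_univ, true_and]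
    rw [hbc]
    have : (k : ℝ) + 1 ≤ n := by
      rw [hn]
      exact_mod_cast hk
    gcongr
  have hAD : A ⊆ D := by
    intro x hx
    by_contra hxD
    simp only [hA, Finset.mem_filter, Finset.mem_univ, true_and] at hx
    rw [hoff x hxD] at hx
    have : 0 < ((k : ℝ) + 1) * c := by positivity
    linarith
  have hflow := hz A ⟨b, hbA⟩ hAD
  have hlow : c ^ 2 * ∑ s ∈ A, μ s * ∑ t ∈ Aᶜ, q s t
      ≤ ∑ x, ∑ y, μ x * q x y * (h x - h y) ^ 2 := by
    have hnn : ∀ x y, 0 ≤ μ x * q x y * (h x - h y) ^ 2 := fun x y =>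
      mul_nonneg (mul_nonneg (hμ.1 x) (hq.1 x y)) (sq_nonneg _)
    calc c ^ 2 * ∑ s ∈ A, μ s * ∑ t ∈ Aᶜ, q s t
        = ∑ x ∈ A, ∑ y ∈ Aᶜ, μ x * q x y * c ^ 2 := by
          simp_rw [Finset.mul_sum]
          refine Finset.sum_congr rfl fun x _ => Finset.sum_congr rfl fun y _ => ?_
          ring
      _ ≤ ∑ x ∈ A, ∑ y ∈ Aᶜ, μ x * q x y * (h x - h y) ^ 2 := by
          refine Finset.sum_le_sum fun x hx => Finset.sum_le_sum fun y hy => ?_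
          refine mul_le_mul_of_nonneg_left ?_ (mul_nonneg (hμ.1 x) (hq.1 x y))
          simp only [hA, Finset.mem_compl, Finset.mem_filter, Finset.mem_univ, true_and] at hx hy
          have hy' := (hgap y).resolve_right hy
          refine pow_le_pow_left₀ hcpos.le ?_ 2
          linarith
      _ ≤ ∑ x ∈ A, ∑ y, μ x * q x y * (h x - h y) ^ 2 :=
          Finset.sum_le_sum fun x _ => Finset.sum_le_univ_sum_of_nonneg (hnn x)
      _ ≤ ∑ x, ∑ y, μ x * q x y * (h x - h y) ^ 2 :=
          Finset.sum_le_univ_sum_of_nonneg fun x => Finset.sum_nonneg fun y _ => hnn x y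
  have h5 : c ^ 2 * z ≤ 2 * (μ b * h b * d) := by
    have := mul_le_mul_of_nonneg_left hflow (sq_nonneg c)
    linarith
  have h6 : h b * (z * h b) ≤ h b * (2 * n ^ 2 * μ b * d) := by
    have h7 := mul_le_mul_of_nonneg_left h5 (sq_nonneg n)
    have h8 : n ^ 2 * (c ^ 2 * z) = h b * (z * h b) := by
      rw [hbc]
      ring
    have h9 : n ^ 2 * (2 * (μ b * h b * d)) = h b * (2 * n ^ 2 * μ b * d) := by ring
    linarith
  exact le_of_mul_le_mul_left h6 hm

lemma IsTransition.outflow_nonneg {q : Matrix S S ℝ} {μ : S → ℝ} (hq : IsTransition q)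
    (hμ : IsStationary q μ) (C : Finset S) : 0 ≤ ∑ s ∈ C, μ s * ∑ t ∈ Cᶜ, q s t :=
  Finset.sum_nonneg fun s _ => mul_nonneg (hμ.1 s) (Finset.sum_nonneg fun t _ => hq.1 s t)

lemma zeta1_le_outflow {q : Matrix S S ℝ} {μ : S → ℝ} (hq : IsTransition q)
    (hμ : IsStationary q μ) {S1 C : Finset S} (hC : C.Nonempty) (hCS : C ⊂ S1) :
    zeta1 q μ S1 ≤ ∑ s ∈ C, μ s * ∑ t ∈ Cᶜ, q s t := by
  refine csInf_le ⟨0, ?_⟩ ⟨C, hC, hCS, rfl⟩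
  rintro x ⟨D, -, -, rfl⟩
  exact hq.outflow_nonneg hμ D

lemma IsStationary.sum_mul_pow {q : Matrix S S ℝ} {μ : S → ℝ} (hμ : IsStationary q μ) (n : ℕ)
    (t : S) : ∑ s, μ s * (q ^ n) s t = μ t := by
  induction n generalizing t with
  | zero => simp [Matrix.one_apply]
  | succ n ih =>
    simp_rw [pow_succ, Matrix.mul_apply, Finset.mul_sum]
    rw [Finset.sum_comm, ← hμ.2.2 t]
    refine Finset.sum_congr rfl fun u _ => ?_
    rw [← ih u, Finset.sum_mul]
    exact Finset.sum_congr rfl fun s _ => by ring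

lemma IsTransition.pow_nonneg {q : Matrix S S ℝ} (hq : IsTransition q) (n : ℕ) (s t : S) :
    0 ≤ (q ^ n) s t :=
  IsSubstochastic.pow_nonneg ⟨hq.1, fun s => (hq.2 s).le⟩ n s t

lemma IsStationary.pos {q : Matrix S S ℝ} {μ : S → ℝ} (hμ : IsStationary q μ)
    (hq : IsTransition q) (hirr : IsIrreducible q) (t : S) : 0 < μ t := by
  obtain ⟨s, hs⟩ : ∃ s, 0 < μ s := by
    by_contra! hcon
    have : ∑ s, μ s ≤ 0 := Finset.sum_nonpos fun s _ => hcon s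
    rw [hμ.2.1] at this
    norm_num at this
  obtain ⟨n, -, hn⟩ := hirr s t
  rw [← hμ.sum_mul_pow n t]
  exact (mul_pos hs hn).trans_le (Finset.single_le_sum
    (f := fun s => μ s * (q ^ n) s t)
    (fun u _ => mul_nonneg (hμ.1 u) (hq.pow_nonneg n u t)) (Finset.mem_univ s))

lemma IsTransition.outflow_pos {q : Matrix S S ℝ} {μ : S → ℝ} (hq : IsTransition q)
    (hirr : IsIrreducible q) (hμ : IsStationary q μ) {C : Finset S} (hC : C.Nonempty)
    {t : S} (ht : t ∉ C) : 0 < ∑ s ∈ C, μ s * ∑ t ∈ Cᶜ, q s t := by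
  refine lt_of_le_of_ne (hq.outflow_nonneg hμ C) fun h0 => ?_
  have h1 : ∀ s ∈ C, ∀ u ∉ C, q s u = 0 := by
    intro s hs u hu
    have h2 := (Finset.sum_eq_zero_iff_of_nonneg fun s _ => mul_nonneg (hμ.1 s)
      (Finset.sum_nonneg fun t _ => hq.1 s t)).mp h0.symm s hs
    have h3 := (mul_eq_zero.mp h2).resolve_left (hμ.pos hq hirr s).ne'
    exact (Finset.sum_eq_zero_iff_of_nonneg fun t _ => hq.1 s t).mp h3 u
      (Finset.mem_compl.mpr hu)
  have h4 : ∀ n : ℕ, ∀ s ∈ C, ∀ u ∉ C, (q ^ n) s u = 0 := by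
    intro n
    induction n with
    | zero =>
      intro s hs u hu
      have : s ≠ u := fun e => hu (e ▸ hs)
      simp [this]
    | succ n ih =>
      intro s hs u hu
      rw [pow_succ, Matrix.mul_apply]
      refine Finset.sum_eq_zero fun v _ => ?_
      by_cases hv : v ∈ C
      · rw [h1 v hv u hu, mul_zero]
      · rw [ih s hs v hv, zero_mul]
  obtain ⟨s, hs⟩ := hC
  obtain ⟨n, -, hn⟩ := hirr s t
  exact hn.ne' (h4 n s hs t ht)

lemma zeta1_pos {q : Matrix S S ℝ} {μ : S → ℝ} (hq : IsTransition q)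
    (hirr : IsIrreducible q) (hμ : IsStationary q μ) {S1 : Finset S} (hS1 : 1 < S1.card) :
    0 < zeta1 q μ S1 := by
  have hfin : {x : ℝ | ∃ C : Finset S, C.Nonempty ∧ C ⊂ S1 ∧
      x = ∑ s ∈ C, μ s * ∑ t ∈ Cᶜ, q s t}.Finite :=
    (Set.finite_range fun C : Finset S => ∑ s ∈ C, μ s * ∑ t ∈ Cᶜ, q s t).subset (by
      rintro x ⟨C, -, -, rfl⟩
      exact ⟨C, rfl⟩)
  obtain ⟨s, hs⟩ : S1.Nonempty := Finset.card_pos.mp (by omega)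
  have hne : {x : ℝ | ∃ C : Finset S, C.Nonempty ∧ C ⊂ S1 ∧
      x = ∑ s ∈ C, μ s * ∑ t ∈ Cᶜ, q s t}.Nonempty := by
    refine ⟨_, {s}, Finset.singleton_nonempty s, ?_, rfl⟩
    refine (Finset.ssubset_iff_subset_ne).mpr ⟨by simpa using hs, fun e => ?_⟩
    rw [← e] at hS1
    simp at hS1
  obtain ⟨C, hC, hCS, hx⟩ := hne.csInf_mem hfin
  obtain ⟨t, -, ht⟩ := Finset.exists_of_ssubset hCS
  rw [zeta1, hx]
  exact hq.outflow_pos hirr hμ hC ht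

lemma det_one_sub_subMat_pos {q : Matrix S S ℝ} {μ : S → ℝ} (hq : IsTransition q)
    (hμ : IsStationary q μ) {z : ℝ} (hz0 : 0 < z) (C : Finset S)
    (hz : ∀ A : Finset S, A.Nonempty → A ⊆ C → z ≤ ∑ s ∈ A, μ s * ∑ t ∈ Aᶜ, q s t) :
    0 < (1 - subMat q C).det := by
  induction C using Finset.induction_on with
  | empty =>
    have : subMat q ∅ = 0 := by
      funext s t
      simp [subMat]
    simp [this]
  | insert b C hb ih =>
    have h1 := ih fun A hA hAC => hz A hA (hAC.trans (Finset.subset_insert b C))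
    have h2 := outflow_mul_det_erase_le hq hμ (Finset.mem_insert_self b C) hz
    rw [Finset.erase_insert hb] at h2
    refine lt_of_le_of_ne (hq.isSubstochastic_subMat _).det_one_sub_nonneg fun h0 => ?_
    rw [← h0, mul_zero] at h2
    exact absurd h2 (not_le.mpr (mul_pos hz0 h1))

lemma prod_mul_det_sdiff_le {q : Matrix S S ℝ} {κ : S → ℝ} {δ : ℝ} {C : Finset S}
    (hκ : ∀ b, 0 ≤ κ b) (hδ : 0 ≤ δ)
    (hstep : ∀ D ⊆ C, ∀ b ∈ D,
      κ b * (1 - subMat q (D.erase b)).det ≤ δ * (1 - subMat q D).det)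
    (B : Finset S) (hB : B ⊆ C) :
    (∏ b ∈ B, κ b) * (1 - subMat q (C \ B)).det ≤ δ ^ #B * (1 - subMat q C).det := by
  induction B using Finset.induction_on with
  | empty => simp
  | insert b B hb ih =>
    have hbC : b ∈ C := hB (Finset.mem_insert_self b B)
    have h1 := ih ((Finset.subset_insert b B).trans hB)
    have h2 := hstep (C \ B) Finset.sdiff_subset b (Finset.mem_sdiff.mpr ⟨hbC, hb⟩)
    rw [Finset.prod_insert hb, Finset.sdiff_insert, Finset.card_insert_of_notMem hb]
    calc κ b * (∏ i ∈ B, κ i) * (1 - subMat q ((C \ B).erase b)).det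
        = (∏ i ∈ B, κ i) * (κ b * (1 - subMat q ((C \ B).erase b)).det) := by ring
      _ ≤ (∏ i ∈ B, κ i) * (δ * (1 - subMat q (C \ B)).det) :=
          mul_le_mul_of_nonneg_left h2 (Finset.prod_nonneg fun i _ => hκ i)
      _ = δ * ((∏ i ∈ B, κ i) * (1 - subMat q (C \ B)).det) := by ring
      _ ≤ δ * (δ ^ #B * (1 - subMat q C).det) := mul_le_mul_of_nonneg_left h1 hδ
      _ = δ ^ (#B + 1) * (1 - subMat q C).det := by ring

/-- Freeing the rows indexed by `B` costs a factor `|S|` for each of them. -/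
lemma sum_prod_compl_mul_det_le {q : Matrix S S ℝ} (hq : IsTransition q) (C B : Finset S) :
    ∑ g : S → S, (∏ b ∈ Bᶜ, q b (g b)) * (1 - subMat (mapMat g) C).det
      ≤ (Fintype.card S : ℝ) ^ #B * (1 - subMat q (C \ B)).det := by
  rcases isEmpty_or_nonempty S with hS | hS
  · have hB : B = ∅ := Finset.eq_empty_of_isEmpty B
    simp [hB]
  have hn : (Fintype.card S : ℝ) ≠ 0 := by simp
  set q' : Matrix S S ℝ := fun b t => if b ∈ B then (Fintype.card S : ℝ)⁻¹ else q b t with hq'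
  have hrow : ∀ b, ∑ t, q' b t = 1 := by
    intro b
    by_cases hb : b ∈ B
    · simp [hq', hb]
    · simpa [hq', hb] using hq.2 b
  have hsub : subMat q' (C \ B) = subMat q (C \ B) := by
    funext u v
    by_cases hu : u ∈ B <;> simp [subMat, hq', hu]
  have hprod : ∀ g : S → S, ∏ b ∈ Bᶜ, q b (g b)
      = (Fintype.card S : ℝ) ^ #B * ∏ b, q' b (g b) := by
    intro g
    rw [← Finset.prod_mul_prod_compl B fun b => q' b (g b)]
    have h1 : ∏ b ∈ B, q' b (g b) = ((Fintype.card S : ℝ)⁻¹) ^ #B := by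
      rw [← Finset.prod_const]
      exact Finset.prod_congr rfl fun b hb => by simp [hq', hb]
    have h2 : ∏ b ∈ Bᶜ, q' b (g b) = ∏ b ∈ Bᶜ, q b (g b) :=
      Finset.prod_congr rfl fun b hb => by
        have : b ∉ B := by simpa using hb
        simp [hq', this]
    rw [h1, h2, ← mul_assoc, ← mul_pow, mul_inv_cancel₀ hn, one_pow, one_mul]
  rw [← hsub, det_eq_sum_maps hrow, Finset.mul_sum]
  refine Finset.sum_le_sum fun g _ => ?_
  rw [← mul_assoc, ← hprod]
  exact mul_le_mul_of_nonneg_left ((isTransition_mapMat g).det_le_det_sdiff C B)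
    (Finset.prod_nonneg fun b _ => hq.1 _ _)

lemma inflated_sum_le {q : Matrix S S ℝ} (hq : IsTransition q) {κ : S → ℝ} {β δ : ℝ}
    {C : Finset S} (hβ : 0 ≤ β) (hκ : ∀ b, 0 ≤ κ b) (hκC : ∀ b ∉ C, κ b = 0) (hδ : 0 ≤ δ)
    (hstep : ∀ D ⊆ C, ∀ b ∈ D,
      κ b * (1 - subMat q (D.erase b)).det ≤ δ * (1 - subMat q D).det) :
    ∑ g : S → S, (∏ b, (κ b + (1 + β) * q b (g b))) * (1 - subMat (mapMat g) C).det
      ≤ (Fintype.card S * δ + (1 + β)) ^ Fintype.card S * (1 - subMat q C).det := by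
  have hW : 0 ≤ (1 - subMat q C).det := (hq.isSubstochastic_subMat C).det_one_sub_nonneg
  have hR : (Fintype.card S * δ + (1 + β)) ^ Fintype.card S
      = ∑ B : Finset S, (Fintype.card S * δ) ^ #B * (1 + β) ^ #Bᶜ := by
    rw [← Finset.card_univ, ← Finset.prod_const, Fintype.prod_add]
    simp [Finset.prod_const]
  rw [hR, Finset.sum_mul]
  simp_rw [Fintype.prod_add, Finset.sum_mul]
  rw [Finset.sum_comm]
  refine Finset.sum_le_sum fun B _ => ?_
  have h1 : ∑ g : S → S, (∏ b ∈ B, κ b) * (∏ b ∈ Bᶜ, (1 + β) * q b (g b))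
        * (1 - subMat (mapMat g) C).det
      = (1 + β) ^ #Bᶜ * ((∏ b ∈ B, κ b) *
        ∑ g : S → S, (∏ b ∈ Bᶜ, q b (g b)) * (1 - subMat (mapMat g) C).det) := by
    simp_rw [Finset.mul_sum, Finset.prod_mul_distrib, Finset.prod_const]
    exact Finset.sum_congr rfl fun g _ => by ring
  rw [h1]
  by_cases hB : B ⊆ C
  · calc (1 + β) ^ #Bᶜ * ((∏ b ∈ B, κ b) *
          ∑ g : S → S, (∏ b ∈ Bᶜ, q b (g b)) * (1 - subMat (mapMat g) C).det)
        ≤ (1 + β) ^ #Bᶜ * ((∏ b ∈ B, κ b) *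
          ((Fintype.card S : ℝ) ^ #B * (1 - subMat q (C \ B)).det)) := by
          have := Finset.prod_nonneg fun b (_ : b ∈ B) => hκ b
          gcongr
          exact sum_prod_compl_mul_det_le hq C B
      _ = (1 + β) ^ #Bᶜ * (Fintype.card S : ℝ) ^ #B * ((∏ b ∈ B, κ b) *
          (1 - subMat q (C \ B)).det) := by ring
      _ ≤ (1 + β) ^ #Bᶜ * (Fintype.card S : ℝ) ^ #B * (δ ^ #B * (1 - subMat q C).det) := by
          exact mul_le_mul_of_nonneg_left (prod_mul_det_sdiff_le hκ hδ hstep B hB)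
            (by positivity)
      _ = (Fintype.card S * δ) ^ #B * (1 + β) ^ #Bᶜ * (1 - subMat q C).det := by
          rw [mul_pow]
          ring
  · obtain ⟨b, hbB, hbC⟩ := Finset.not_subset.mp hB
    rw [Finset.prod_eq_zero hbB (hκC b hbC), zero_mul, mul_zero]
    positivity

/-- Closeness gives an entrywise bound valid for all transitions. -/
lemma IsClose.abs_sub_le {ι : Type*} [Fintype ι] {q qh : Matrix ι ι ℝ} {μ : ι → ℝ} {z ε β : ℝ}
    (h : IsClose q qh μ z ε β) (hq : IsTransition q) (hqh : IsTransition qh) (hβ : 0 ≤ β)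
    (hμ : ∀ s, 0 < μ s) (hz : 0 ≤ ε * z) (s t : ι) :
    |qh s t - q s t| ≤ ε * z / μ s + β * q s t := by
  by_cases hc : ε * z ≤ μ s * q s t ∨ ε * z ≤ μ s * qh s t
  · have := h s t hc
    have := div_nonneg hz (hμ s).le
    linarith
  · push Not at hc
    have h1 : q s t < ε * z / μ s := by
      rw [lt_div_iff₀ (hμ s)]
      linarith
    have h2 : qh s t < ε * z / μ s := by
      rw [lt_div_iff₀ (hμ s)]
      linarith
    have h3 := hq.1 s t
    have h4 := hqh.1 s t
    have h5 := mul_nonneg hβ h3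
    rw [abs_le]
    constructor <;> linarith

lemma Mixing.le_one {q : Matrix S S ℝ} {S1 : Finset S} {a : ℝ} (h : Mixing q S1 a)
    (hq : IsTransition q) (hS1 : S1.Nonempty) : a ≤ 1 := by
  obtain ⟨s, hs⟩ := hS1
  refine (h s hs s hs).trans ?_
  calc q s s + ∑ u ∈ S1.erase s, q s u * exitProb q (S1.erase s) u s
      ≤ q s s + ∑ u ∈ S1.erase s, q s u * 1 := by
        gcongr with u hu
        · exact hq.1 s u
        · exact hq.exitProb_le_one (Finset.notMem_erase s S1) u
    _ = ∑ u ∈ S1, q s u := by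
        simp_rw [mul_one]
        exact Finset.add_sum_erase S1 (q s) hs
    _ ≤ ∑ u, q s u := Finset.sum_le_univ_sum_of_nonneg (hq.1 s)
    _ = 1 := hq.2 s

lemma card_le_Lconst {ι : Type*} [Fintype ι] (hcard : 2 ≤ Fintype.card ι) :
    Fintype.card ι ≤ Lconst ι := by
  unfold Lconst
  have := Finset.single_le_sum
    (f := fun n => (Fintype.card ι).choose n * n ^ Fintype.card ι)
    (fun n _ => Nat.zero_le _) (Finset.mem_Ico.mpr ⟨le_refl 1, hcard⟩)
  simpa using this

/-- The exit distribution only depends on the rows indexed by `C`. -/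
lemma exitProb_congr {q q' : Matrix S S ℝ} {C : Finset S} (h : ∀ u ∈ C, ∀ v, q u v = q' u v)
    (s t : S) : exitProb q C s t = exitProb q' C s t := by
  have h1 : subMat q C = subMat q' C := by
    funext u v
    unfold subMat
    split_ifs with huv
    · exact h u huv.1 v
    · rfl
  unfold exitProb
  rw [h1]
  exact tsum_congr fun n => Finset.sum_congr rfl fun u hu => by rw [h u hu]

/-- The numerical estimate on the total relative perturbation. -/
lemma one_add_pow_bounds {n : ℕ} {L β ε a : ℝ} (hn : 2 ≤ n) (hL : (n : ℝ) ≤ L)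
    (hβ0 : 0 < β) (hβ1 : β < 1 / 2 ^ n) (ha0 : 0 < a) (ha1 : a ≤ 1) (hε0 : 0 < ε)
    (hε1 : ε < 1 / 2 * (a / L) ^ n * (β * (1 - β) / (L * (n : ℝ) ^ 4))) :
    (n * (2 * n ^ 2 * ε) + (1 + β)) ^ n - 1 < 1 ∧
      2 * ((n * (2 * n ^ 2 * ε) + (1 + β)) ^ n - 1) < 12 * β * L := by
  have hn' : (2 : ℝ) ≤ n := by exact_mod_cast hn
  have hL2 : 2 ≤ L := hn'.trans hL
  have hL0 : 0 < L := by linarith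
  have hn0 : (0 : ℝ) < n := by linarith
  have haL : a / L ≤ 1 / 2 := by
    rw [div_le_iff₀ hL0]
    linarith
  have hpow : (a / L) ^ n ≤ 1 / 2 :=
    (pow_le_of_le_one (by positivity) (by linarith) (by omega)).trans haL
  have hnβ : n * β ≤ 1 / 2 := by
    have h1 : 2 * n ≤ 2 ^ n := by
      obtain ⟨k, rfl⟩ := Nat.exists_eq_add_of_le' (show 1 ≤ n by omega)
      have := Nat.lt_two_pow_self (n := k)
      rw [pow_succ]
      omega
    have h2 : (2 * n : ℝ) ≤ 2 ^ n := by exact_mod_cast h1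
    have h3 : β * 2 ^ n < 1 := by
      rwa [lt_div_iff₀ (by positivity)] at hβ1
    nlinarith
  have hβ' : β * (1 - β) ≤ β := by nlinarith
  have hε2 : ε * (L * (n : ℝ) ^ 4) ≤ β / 4 := by
    have h1 : ε ≤ 1 / 2 * (1 / 2) * (β / (L * (n : ℝ) ^ 4)) := by
      refine hε1.le.trans ?_
      have : 0 ≤ β * (1 - β) := mul_nonneg hβ0.le (by nlinarith)
      gcongr
    calc ε * (L * (n : ℝ) ^ 4)
        ≤ 1 / 2 * (1 / 2) * (β / (L * (n : ℝ) ^ 4)) * (L * (n : ℝ) ^ 4) := by gcongr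
      _ = β / 4 := by
        field_simp
        norm_num
  have hδ : n * (2 * n ^ 2 * ε) ≤ β / 8 := by
    have h1 : 4 * (n : ℝ) ^ 3 ≤ L * n ^ 4 := by
      have h4 : (4 : ℝ) ≤ L * n := by nlinarith
      calc 4 * (n : ℝ) ^ 3 ≤ L * n * n ^ 3 := by gcongr
        _ = L * n ^ 4 := by ring
    nlinarith [mul_le_mul_of_nonneg_left h1 hε0.le]
  set x : ℝ := n * (9 / 8 * β) with hx
  have hx0 : 0 < x := by positivity
  have hx1 : x ≤ 9 / 16 := by
    rw [hx]
    linarith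
  have hexp : (n * (2 * n ^ 2 * ε) + (1 + β)) ^ n ≤ 1 + x + x ^ 2 := by
    calc (n * (2 * n ^ 2 * ε) + (1 + β)) ^ n ≤ (Real.exp (9 / 8 * β)) ^ n := by
          have := Real.add_one_le_exp (9 / 8 * β)
          gcongr
          linarith
      _ = Real.exp x := by rw [← Real.exp_nat_mul]
      _ ≤ 1 + x + x ^ 2 := by
          have := (abs_le.mp (Real.abs_exp_sub_one_sub_id_le (x := x)
            (by rw [abs_of_pos hx0]; linarith))).2
          linarith
  have hxL : x ≤ 9 / 8 * (β * L) := by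
    rw [hx]
    nlinarith
  have hβL : 0 < β * L := by positivity
  constructor <;> nlinarith

/-- exit distributions from nonempty proper subsets of `S₁` are close:
`|Q_{s,q}(t|C) − Q_{s,q̂}(t|C)| < 12βL`. -/
theorem perturbed_exit_close_on_subset
    (hcard : 2 ≤ Fintype.card S)
    (q qh : Matrix S S ℝ) (μ : S → ℝ) (S1 : Finset S) (hS1 : 1 < S1.card)
    (β ε a : ℝ)
    (hβ0 : 0 < β) (hβ1 : β < 1 / 2 ^ Fintype.card S) (ha : 0 < a)
    (hε0 : 0 < ε)
    (hε1 : ε < 1 / 2 * (a / (Lconst S : ℝ)) ^ Fintype.card S *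
        (β * (1 - β) / ((Lconst S : ℝ) * (Fintype.card S : ℝ) ^ 4)))
    (hq : IsTransition q) (hqirr : IsIrreducible q) (hμ : IsStationary q μ)
    (hmix : Mixing q S1 a)
    (hqh : IsTransition qh)
    (hclose : IsClose q qh μ (zeta1 q μ S1) ε β)
    (hcoin : ∀ s ∉ S1, ∀ t, qh s t = q s t) :
    ∀ C : Finset S, C.Nonempty → C ⊂ S1 → ∀ s ∈ C, ∀ t ∉ C,
      |exitProb q C s t - exitProb qh C s t| < 12 * β * (Lconst S : ℝ) := by
  intro C hC hCS s hs t ht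
  have hμpos := hμ.pos hq hqirr
  have hz0 : 0 < zeta1 q μ S1 := zeta1_pos hq hqirr hμ hS1
  have hz : ∀ A : Finset S, A.Nonempty → A ⊆ C →
      zeta1 q μ S1 ≤ ∑ s ∈ A, μ s * ∑ t ∈ Aᶜ, q s t := fun A hA hAC =>
    zeta1_le_outflow hq hμ hA (lt_of_le_of_lt hAC hCS)
  have ha1 : a ≤ 1 := hmix.le_one hq (Finset.card_pos.mp (by omega))
  obtain ⟨hη1, hη2⟩ := one_add_pow_bounds hcard (Nat.cast_le.mpr (card_le_Lconst hcard))
    hβ0 hβ1 ha ha1 hε0 hε1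
  set n : ℝ := (Fintype.card S : ℝ)
  have hεz : 0 < ε * zeta1 q μ S1 := mul_pos hε0 hz0
  set κ : S → ℝ := fun b => if b ∈ C then ε * zeta1 q μ S1 / μ b else 0 with hκdef
  set q' : Matrix S S ℝ := fun b v => if b ∈ C then qh b v else q b v with hq'def
  have hq' : IsTransition q' := by
    refine ⟨fun u v => ?_, fun u => ?_⟩ <;> by_cases hu : u ∈ C <;>
      simp [hq'def, hu, hq.1, hqh.1, hq.2, hqh.2]
  have hκ0 : ∀ b, 0 ≤ κ b := by
    intro b
    simp only [hκdef]
    split_ifs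
    · exact div_nonneg hεz.le (hμpos b).le
    · exact le_rfl
  have hstep : ∀ D ⊆ C, ∀ b ∈ D, κ b * (1 - subMat q (D.erase b)).det
      ≤ 2 * n ^ 2 * ε * (1 - subMat q D).det := by
    intro D hD b hb
    have h1 := outflow_mul_det_erase_le hq hμ hb fun A hA hAD => hz A hA (hAD.trans hD)
    simp only [hκdef, if_pos (hD hb)]
    rw [div_mul_eq_mul_div, div_le_iff₀ (hμpos b)]
    have h2 := mul_le_mul_of_nonneg_left h1 hε0.le
    linarith
  have hclose' : ∀ u v, |q' u v - q u v| ≤ (κ u + (1 + β) * q u v) - q u v := by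
    intro u v
    by_cases hu : u ∈ C
    · have := hclose.abs_sub_le hq hqh hβ0.le hμpos hεz.le u v
      simp only [hκdef, hq'def, hu, if_true]
      linarith
    · have := mul_nonneg hβ0.le (hq.1 u v)
      simp only [hκdef, hq'def, hu, if_false, sub_self, abs_zero]
      linarith
  have hsum := inflated_sum_le hq hβ0.le hκ0 (fun b hb => by simp [hκdef, hb])
    (show 0 ≤ 2 * n ^ 2 * ε by positivity) hstep
  rw [exitProb_congr (q := qh) (q' := q') fun u hu v => by simp [hq'def, hu]]
  refine lt_of_le_of_lt (abs_exitProb_sub_le hq hq'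
    (y := fun u v => κ u + (1 + β) * q u v) hclose' hη1
    (det_one_sub_subMat_pos hq hμ hz0 C hz) (hsum.trans_eq ?_) ht) hη2
  ring

end PerturbedMC
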